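/- Let a, b, c > 0 with a+b = c. Then M(a,b,c,x) → 1/B(a,b) as x → 0+ and as x → 1−. Moreover, if a+b < c, then M(a,b,c,x) → 0 as x → 0+ and as x → 1−. -/

import Mathlib

open Filter Set

/-- Shifted factorial (Appell symbol) `(a,n) = a(a+1)⋯(a+n−1)`, with `(a,0)=1`. -/
noncomputable def shiftedFact (a : ℝ) (n : ℕ) : ℝ := ∏ i ∈ Finset.range n, (a + i)

/-- Gaussian hypergeometric function `F(a,b;c;x)` as a real power series. -/
noncomputable def hypF (a b c x : ℝ) : ℝ :=
  ∑' n : ℕ, (shiftedFact a n * shiftedFact b n / (shiftedFact c n * (n.factorial : ℝ))) * x ^ n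

/-- Beta function `B(x,y) = Γ(x)Γ(y)/Γ(x+y)`. -/
noncomputable def betaR (x y : ℝ) : ℝ := Real.Gamma x * Real.Gamma y / Real.Gamma (x + y)

/-- `M(a,b,c,x) = x(1−x)(v₁(x)v'(x) − v(x)v₁'(x))` with `v(x)=F(a,b;c;x)`, `v₁(x)=F(a,b;c;1−x)`. -/
noncomputable def Mfun (a b c x : ℝ) : ℝ :=
  x * (1 - x) * (hypF a b c (1 - x) * deriv (fun t => hypF a b c t) x
    - hypF a b c x * deriv (fun t => hypF a b c (1 - t)) x)

open scoped Topology

lemma summable_mul_pow_of_abs_le {u : ℕ → ℝ} {C x : ℝ} (hu : ∀ n, |u n| ≤ C) (hx : |x| < 1) :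
    Summable fun n ↦ u n * x ^ n := by
  refine Summable.of_norm_bounded
    ((summable_geometric_of_lt_one (abs_nonneg x) hx).mul_left C) fun n ↦ ?_
  rw [Real.norm_eq_abs, abs_mul, abs_pow]
  gcongr
  exact hu n

lemma tendsto_tsum_mul_pow_zero {u : ℕ → ℝ} {C : ℝ} (hu : ∀ n, |u n| ≤ C) :
    Tendsto (fun x : ℝ ↦ ∑' n, u n * x ^ n) (𝓝 0) (𝓝 (u 0)) := by
  have h : Tendsto (fun x : ℝ ↦ ∑' n, u n * x ^ n) (𝓝 0) (𝓝 (∑' n, u n * (0 : ℝ) ^ n)) := by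
    refine tendsto_tsum_of_dominated_convergence (bound := fun n ↦ C * (1 / 2 : ℝ) ^ n)
      (summable_geometric_two.mul_left C) (fun n ↦ ?_) ?_
    · exact ((continuous_const.mul (continuous_pow n)).tendsto (0 : ℝ))
    · filter_upwards [Metric.ball_mem_nhds (0 : ℝ) (by norm_num : (0 : ℝ) < 1 / 2)] with x hx n
      rw [Metric.mem_ball, dist_zero_right, Real.norm_eq_abs] at hx
      rw [Real.norm_eq_abs, abs_mul, abs_pow]
      have hC : 0 ≤ C := (abs_nonneg _).trans (hu n)
      gcongr
      exact hu n
  rwa [tsum_eq_single 0 fun n hn ↦ by simp [hn], pow_zero, mul_one] at h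

/-- An Abelian theorem: if the coefficients converge to `L`, the power series is asymptotic to
`L / (1 - x)` as `x → 1-`. -/
lemma tendsto_one_sub_mul_tsum_mul_pow {u : ℕ → ℝ} {L : ℝ} (hu : Tendsto u atTop (𝓝 L)) :
    Tendsto (fun x : ℝ ↦ (1 - x) * ∑' n, u n * x ^ n) (𝓝[<] 1) (𝓝 L) := by
  obtain ⟨C, hC⟩ := (Metric.isBounded_range_of_tendsto u hu).exists_norm_le
  replace hC : ∀ n, |u n| ≤ C := fun n ↦ hC _ (mem_range_self n)
  obtain ⟨f, hf0, hfsucc⟩ : ∃ f : ℕ → ℝ, f 0 = u 0 ∧ ∀ n, f (n + 1) = u (n + 1) - u n :=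
    ⟨fun n ↦ Nat.casesOn n (u 0) fun k ↦ u (k + 1) - u k, rfl, fun _ ↦ rfl⟩
  have hf : ∀ n, ∑ i ∈ Finset.range (n + 1), f i = u n := fun n ↦ by
    simp only [Finset.sum_range_succ', hfsucc, hf0, Finset.sum_range_sub]
    ring
  have hlim : Tendsto (fun n ↦ ∑ i ∈ Finset.range n, f i) atTop (𝓝 L) := by
    rw [← tendsto_add_atTop_iff_nat 1]
    simpa only [hf] using hu
  refine (Real.tendsto_tsum_powerSeries_nhdsWithin_lt hlim).congr' ?_
  filter_upwards [Ioo_mem_nhdsLT (zero_lt_one' ℝ)] with x hx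
  have hx1 : |x| < 1 := abs_lt.2 ⟨by linarith [hx.1], hx.2⟩
  have hs := summable_mul_pow_of_abs_le hC hx1
  have hs' := (summable_nat_add_iff 1).2 hs
  have hfs : (fun n ↦ f (n + 1) * x ^ (n + 1)) =
      fun n ↦ u (n + 1) * x ^ (n + 1) - x * (u n * x ^ n) := by
    ext n
    rw [hfsucc]
    ring
  have hsum : Summable fun n ↦ f (n + 1) * x ^ (n + 1) := by
    rw [hfs]
    exact hs'.sub (hs.mul_left x)
  have hfx : Summable fun n ↦ f n * x ^ n := (summable_nat_add_iff 1).1 hsum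
  rw [hfx.tsum_eq_zero_add, hfs, hs'.tsum_sub (hs.mul_left x), tsum_mul_left, hf0]
  have h0 := hs.tsum_eq_zero_add
  linear_combination -h0

lemma deriv_tsum_mul_pow {A : ℕ → ℝ} {C x : ℝ} (hA : ∀ n, |A n| ≤ C)
    (hA' : ∀ n : ℕ, |(n + 1 : ℝ) * A (n + 1)| ≤ C) (hx : |x| < 1) :
    deriv (fun t ↦ ∑' n, A n * t ^ n) x = ∑' n : ℕ, ((n + 1 : ℝ) * A (n + 1)) * x ^ n := by
  obtain ⟨r, hxr, hr⟩ := exists_between hx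
  have hr0 : 0 < r := (abs_nonneg x).trans_lt hxr
  have hbound : Summable fun n : ℕ ↦ C * r ^ (n - 1) := by
    rw [← summable_nat_add_iff 1]
    simpa using (summable_geometric_of_lt_one hr0.le hr).mul_left C
  have h := hasDerivAt_tsum_of_isPreconnected (y₀ := x) (y := x) (t := Ioo (-r) r)
    (g := fun n t ↦ A n * t ^ n) (g' := fun n t ↦ A n * (n * t ^ (n - 1)))
    hbound isOpen_Ioo isPreconnected_Ioo (fun n y _ ↦ (hasDerivAt_pow n y).const_mul (A n))
    (fun n y hy ↦ ?_) (abs_lt.1 hxr) (summable_mul_pow_of_abs_le hA hx) (abs_lt.1 hxr)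
  · rw [h.deriv]
    have hs : Summable fun n : ℕ ↦ A (n + 1) * (((n + 1 : ℕ) : ℝ) * x ^ (n + 1 - 1)) := by
      refine (summable_mul_pow_of_abs_le hA' hx).congr fun n ↦ ?_
      rw [Nat.add_sub_cancel]
      push_cast
      ring
    have hs0 : Summable fun n : ℕ ↦ A n * (n * x ^ (n - 1)) := (summable_nat_add_iff 1).1 hs
    rw [hs0.tsum_eq_zero_add]
    simp only [Nat.cast_zero, zero_mul, mul_zero, zero_add]
    refine tsum_congr fun n ↦ ?_
    rw [Nat.add_sub_cancel]
    push_cast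
    ring
  · have hC : 0 ≤ C := (abs_nonneg _).trans (hA 0)
    rcases n with _ | n
    · simpa using hC
    · have hy' : |y| ≤ r := (abs_lt.2 hy).le
      calc ‖A (n + 1) * (((n + 1 : ℕ) : ℝ) * y ^ (n + 1 - 1))‖
          = |(n + 1 : ℝ) * A (n + 1)| * |y| ^ n := by
            rw [Real.norm_eq_abs, ← abs_pow, ← abs_mul, Nat.add_sub_cancel]
            congr 1
            push_cast
            ring
        _ ≤ C * r ^ (n + 1 - 1) := by
            rw [Nat.add_sub_cancel]
            gcongr
            exact hA' n

lemma tendsto_of_tendsto_succ_mul {A : ℕ → ℝ} {L : ℝ}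
    (hA : Tendsto (fun n : ℕ ↦ (n + 1 : ℝ) * A (n + 1)) atTop (𝓝 L)) :
    Tendsto A atTop (𝓝 0) := by
  rw [← tendsto_add_atTop_iff_nat 1]
  have h := hA.mul (tendsto_one_div_add_atTop_nhds_zero_nat (𝕜 := ℝ))
  rw [mul_zero] at h
  refine h.congr fun n ↦ ?_
  have : (n + 1 : ℝ) ≠ 0 := by positivity
  field_simp

/-- The coefficient of `x ^ n` in `F(a,b;c;x)`. -/
noncomputable def hypCoeff (a b c : ℝ) (n : ℕ) : ℝ :=
  shiftedFact a n * shiftedFact b n / (shiftedFact c n * (n.factorial : ℝ))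

lemma Mfun_one_sub (a b c x : ℝ) : Mfun a b c (1 - x) = Mfun a b c x := by
  simp only [Mfun, deriv_comp_const_sub (f := fun t ↦ hypF a b c t), sub_sub_cancel]
  ring

lemma tendsto_Mfun {a b c L : ℝ}
    (h : Tendsto (fun n : ℕ ↦ (n + 1 : ℝ) * hypCoeff a b c (n + 1)) atTop (𝓝 L)) :
    Tendsto (Mfun a b c) (𝓝[>] 0) (𝓝 L) ∧ Tendsto (Mfun a b c) (𝓝[<] 1) (𝓝 L) := by
  have hflip : Tendsto (fun x : ℝ ↦ 1 - x) (𝓝[>] 0) (𝓝[<] 1) := by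
    refine tendsto_nhdsWithin_iff.2 ⟨?_, ?_⟩
    · exact (Continuous.tendsto' (by fun_prop) _ _ (by simp)).mono_left nhdsWithin_le_nhds
    · filter_upwards [self_mem_nhdsWithin] with x hx
      simpa using hx
  have hflip' : Tendsto (fun x : ℝ ↦ 1 - x) (𝓝[<] 1) (𝓝[>] 0) := by
    refine tendsto_nhdsWithin_iff.2 ⟨?_, ?_⟩
    · exact (Continuous.tendsto' (by fun_prop) _ _ (by simp)).mono_left nhdsWithin_le_nhds
    · filter_upwards [self_mem_nhdsWithin] with x hx
      simpa using hx
  suffices h0 : Tendsto (Mfun a b c) (𝓝[>] 0) (𝓝 L) from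
    ⟨h0, (h0.comp hflip').congr fun x ↦ Mfun_one_sub a b c x⟩
  set A := hypCoeff a b c with hAdef
  set u : ℕ → ℝ := fun n ↦ (n + 1 : ℝ) * A (n + 1)
  have hA := tendsto_of_tendsto_succ_mul h
  obtain ⟨C₁, hC₁⟩ := (Metric.isBounded_range_of_tendsto A hA).exists_norm_le
  obtain ⟨C₂, hC₂⟩ := (Metric.isBounded_range_of_tendsto u h).exists_norm_le
  have hAC : ∀ n, |A n| ≤ max C₁ C₂ := fun n ↦
    (hC₁ _ (mem_range_self n)).trans (le_max_left _ _)
  have huC : ∀ n, |u n| ≤ max C₁ C₂ := fun n ↦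
    (hC₂ _ (mem_range_self n)).trans (le_max_right _ _)
  have hA0 : A 0 = 1 := by simp [hAdef, hypCoeff, shiftedFact]
  have hF : Tendsto (fun x : ℝ ↦ ∑' n, A n * x ^ n) (𝓝[>] 0) (𝓝 1) :=
    hA0 ▸ (tendsto_tsum_mul_pow_zero hAC).mono_left nhdsWithin_le_nhds
  have hF' : Tendsto (fun x : ℝ ↦ ∑' n, u n * x ^ n) (𝓝[>] 0) (𝓝 (u 0)) :=
    (tendsto_tsum_mul_pow_zero huC).mono_left nhdsWithin_le_nhds
  have hG := (tendsto_one_sub_mul_tsum_mul_pow hA).comp hflip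
  have hG' := (tendsto_one_sub_mul_tsum_mul_pow h).comp hflip
  have hid : Tendsto (fun x : ℝ ↦ 1 - x) (𝓝[>] 0) (𝓝 1) :=
    hflip.mono_right nhdsWithin_le_nhds
  have hlim := hid.mul ((hG.mul hF').add (hF.mul hG'))
  rw [zero_mul, zero_add, one_mul, one_mul] at hlim
  refine hlim.congr' ?_
  filter_upwards [Ioo_mem_nhdsGT (zero_lt_one' ℝ)] with x hx
  have hx1 : |x| < 1 := abs_lt.2 ⟨by linarith [hx.1], hx.2⟩
  have hx2 : |1 - x| < 1 := abs_lt.2 ⟨by linarith [hx.2], by linarith [hx.1]⟩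
  have hFA : (fun t ↦ hypF a b c t) = fun t ↦ ∑' n, A n * t ^ n := rfl
  have hFA' : ∀ t, hypF a b c t = ∑' n, A n * t ^ n := fun _ ↦ rfl
  simp only [Function.comp_apply, Mfun, deriv_comp_const_sub (f := fun t ↦ hypF a b c t)]
  rw [hFA, deriv_tsum_mul_pow hAC huC hx1, deriv_tsum_mul_pow hAC huC hx2, hFA', hFA']
  ring

lemma tendsto_hypCoeff_succ_mul {a b c l : ℝ} (ha : 0 < a) (hb : 0 < b) (hc : 0 < c)
    (hl : Tendsto (fun n : ℕ ↦ (n : ℝ) ^ (a + b - c)) atTop (𝓝 l)) :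
    Tendsto (fun n : ℕ ↦ (n + 1 : ℝ) * hypCoeff a b c (n + 1)) atTop
      (𝓝 (l * (Real.Gamma c / (Real.Gamma a * Real.Gamma b)))) := by
  have hpos : ∀ {s : ℝ}, 0 < s → ∀ n, 0 < shiftedFact s n := fun hs n ↦
    Finset.prod_pos fun i _ ↦ by positivity
  refine (hl.mul ((Real.GammaSeq_tendsto_Gamma c).div
    ((Real.GammaSeq_tendsto_Gamma a).mul (Real.GammaSeq_tendsto_Gamma b))
    (mul_pos (Real.Gamma_pos_of_pos ha) (Real.Gamma_pos_of_pos hb)).ne')).congr' ?_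
  filter_upwards [eventually_gt_atTop 0] with n hn
  have hn' : (0 : ℝ) < n := Nat.cast_pos.2 hn
  have hG : ∀ s, Real.GammaSeq s n = (n : ℝ) ^ s * n.factorial / shiftedFact s (n + 1) :=
    fun _ ↦ rfl
  have h1 := (hpos ha (n + 1)).ne'
  have h2 := (hpos hb (n + 1)).ne'
  have h3 := (hpos hc (n + 1)).ne'
  have h4 : (n.factorial : ℝ) ≠ 0 := by positivity
  have h5 := (Real.rpow_pos_of_pos hn' a).ne'
  have h6 := (Real.rpow_pos_of_pos hn' b).ne'
  have h7 := (Real.rpow_pos_of_pos hn' c).ne'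
  have h8 : (n + 1 : ℝ) ≠ 0 := by positivity
  simp only [Pi.div_apply, hG, hypCoeff, Nat.factorial_succ, Nat.cast_mul, Nat.cast_succ]
  rw [Real.rpow_sub hn', Real.rpow_add hn']
  field_simp

theorem stmt6 (a b c : ℝ) (ha : 0 < a) (hb : 0 < b) (hc : 0 < c) :
    (a + b = c →
      Tendsto (Mfun a b c) (nhdsWithin 0 (Set.Ioi 0)) (nhds (1 / betaR a b)) ∧
      Tendsto (Mfun a b c) (nhdsWithin 1 (Set.Iio 1)) (nhds (1 / betaR a b))) ∧
    (a + b < c →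
      Tendsto (Mfun a b c) (nhdsWithin 0 (Set.Ioi 0)) (nhds 0) ∧
      Tendsto (Mfun a b c) (nhdsWithin 1 (Set.Iio 1)) (nhds 0)) := by
  refine ⟨fun h ↦ ?_, fun h ↦ ?_⟩
  · have hl : Tendsto (fun n : ℕ ↦ (n : ℝ) ^ (a + b - c)) atTop (𝓝 1) := by
      simp [h]
    have hlim := tendsto_hypCoeff_succ_mul ha hb hc hl
    rw [one_mul, ← one_div_div, ← h] at hlim
    exact tendsto_Mfun (h ▸ hlim)
  · have hl : Tendsto (fun n : ℕ ↦ (n : ℝ) ^ (a + b - c)) atTop (𝓝 0) := by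
      have := (tendsto_rpow_neg_atTop (sub_pos.2 h)).comp 
        (tendsto_natCast_atTop_atTop (R := ℝ))
      simpa [Function.comp_def] using this
    have hlim := tendsto_hypCoeff_succ_mul ha hb hc hl
    rw [zero_mul] at hlim
    exact tendsto_Mfun hlim
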